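/- If an axis-aligned candidate box S (maximal B-empty box containing S_min) has five of its six supporting blue points in the closed halfspace H = {x : x₁ ≥ b₁} to the right of S_min, then at most four of those supports can lie in a perpendicular halfspace H⊥ = {x : x₂ ≥ b₂}; moreover no more than five supports of any candidate box lie in any single halfspace bounded by a supporting plane of S_min and disjoint from the interior of S_min. -/

import Mathlib

/-- Membership in one of the six closed halfspaces of `S_min = [a,b]`: the halfspace
bounded by the plane supporting a face of `S_min` and not meeting its interior.
`pos = true` gives `{x | b k ≤ x k}`, `pos = false` gives `{x | x k ≤ a k}`. -/
def inHalfspace (a b : Fin 3 → ℝ) (k : Fin 3) (pos : Bool) (x : Fin 3 → ℝ) : Prop :=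
  if pos then b k ≤ x k else x k ≤ a k

open scoped Classical

/-- The support of the face of `[u,v]` opposite to a halfspace of `[a,b]` is outside it. -/
theorem not_inHalfspace_opposite_support {a b u v : Fin 3 → ℝ}
    (hab : ∀ i, a i < b i) (hcontain : ∀ i, u i ≤ a i ∧ b i ≤ v i)
    {supp : Fin 3 → Bool → (Fin 3 → ℝ)}
    (hsupp : ∀ k, supp k false k = u k ∧ supp k true k = v k) (k : Fin 3) (pos : Bool) :
    ¬ inHalfspace a b k pos (supp k (!pos)) := by
  have := hab k
  have := hcontain k
  have := hsupp k
  cases pos <;> simp only [inHalfspace, Bool.not_true, Bool.not_false, if_true, not_le,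
    Bool.false_eq_true, if_false] <;> linarith

/-- Let `S = [u,v]` be a candidate box containing the (nondegenerate) minimal enclosing
box `S_min = [a,b]` of the red points, and let `supp k s` (for `k : Fin 3`,
`s : Bool`) be its six blue supports, each lying in the relative interior of the
corresponding face of `S`.  Then for every halfspace `H` of `S_min` at most 5 of the 6
supports lie in `H`, and for any two perpendicular halfspaces `H`, `H⊥` of `S_min`
(e.g. `{x₁ ≥ b₁}` and `{x₂ ≥ b₂}`) at most 4 of the supports lie in `H ∩ H⊥`. -/
theorem supports_in_halfspaces_bound
    (R B : Set (Fin 3 → ℝ)) (hR : R.Finite) (hB : B.Finite)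
    (a b u v : Fin 3 → ℝ)
    (hab : ∀ i, a i < b i)
    (hmin : R ⊆ {x | ∀ i, a i ≤ x i ∧ x i ≤ b i})
    (hcontain : ∀ i, u i ≤ a i ∧ b i ≤ v i)
    (hempty : {x : Fin 3 → ℝ | ∀ i, u i < x i ∧ x i < v i} ∩ B = ∅)
    (supp : Fin 3 → Bool → (Fin 3 → ℝ))
    (hsuppB : ∀ k s, supp k s ∈ B)
    (hsupp : ∀ k : Fin 3, (supp k false) k = u k ∧ (supp k true) k = v k ∧
      ∀ s : Bool, ∀ j, j ≠ k → u j < (supp k s) j ∧ (supp k s) j < v j) :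
    (∀ (k : Fin 3) (pos : Bool),
      (Finset.univ.filter
        (fun f : Fin 3 × Bool => inHalfspace a b k pos (supp f.1 f.2))).card ≤ 5) ∧
    (∀ (k k' : Fin 3) (pos pos' : Bool), k ≠ k' →
      (Finset.univ.filter
        (fun f : Fin 3 × Bool => inHalfspace a b k pos (supp f.1 f.2) ∧
          inHalfspace a b k' pos' (supp f.1 f.2))).card ≤ 4) := by
  have hout := not_inHalfspace_opposite_support hab hcontain
    (fun k => ⟨(hsupp k).1, (hsupp k).2.1⟩)
  refine ⟨fun k pos => ?_, fun k k' pos pos' hk => ?_⟩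
  · calc _ ≤ (Finset.univ.erase (k, !pos)).card := Finset.card_le_card fun f hf => by
          refine Finset.mem_erase.2 ⟨?_, Finset.mem_univ f⟩
          rintro rfl
          exact hout k pos (Finset.mem_filter.1 hf).2
      _ = 5 := by simp [Finset.card_erase_of_mem]
  · calc _ ≤ ((Finset.univ.erase (k, !pos)).erase (k', !pos')).card :=
          Finset.card_le_card fun f hf => by
            have hf := (Finset.mem_filter.1 hf).2
            refine Finset.mem_erase.2 ⟨?_, Finset.mem_erase.2 ⟨?_, Finset.mem_univ f⟩⟩
            · rintro rfl
              exact hout k' pos' hf.2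
            · rintro rfl
              exact hout k pos hf.1
      _ = 4 := by simp [Finset.card_erase_of_mem, hk.symm]
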